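/- arXiv:1409.6770 — 3 statements merged into one kernel-verified Lean document; each statement's English description precedes it below -/
import Mathlib

section
/- Let f : [a,b] → ℝ be a bounded function. If f is right-endpoint Riemann integrable on [a,b], then f is Riemann integrable on [a,b] (equivalently, Darboux integrable, with the same value of the integral). -/
open Finset Set

/-- `IsPartition a b n x` : `x 0 = a < x 1 < ... < x n = b` is a partition of `[a,b]`
into `n` subintervals. -/
def IsPartition (a b : ℝ) (n : ℕ) (x : ℕ → ℝ) : Prop :=
  0 < n ∧ x 0 = a ∧ x n = b ∧ ∀ k < n, x k < x (k + 1)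

/-- The mesh of the partition is `< δ`, i.e. every subinterval has length `< δ`. -/
def MeshLT (n : ℕ) (x : ℕ → ℝ) (δ : ℝ) : Prop :=
  ∀ k < n, x (k + 1) - x k < δ

/-- The Riemann sum of `f` w.r.t. the partition `x` with sample points `t k ∈ [x k, x (k+1)]`. -/
def RiemannSum (f : ℝ → ℝ) (n : ℕ) (x t : ℕ → ℝ) : ℝ :=
  ∑ k ∈ Finset.range n, f (t k) * (x (k + 1) - x k)

/-- `f` is Riemann integrable on `[a,b]` with value `L`. -/
def RiemannIntegrableWith (a b : ℝ) (f : ℝ → ℝ) (L : ℝ) : Prop :=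
  ∀ ε > 0, ∃ δ > 0, ∀ n : ℕ, ∀ x t : ℕ → ℝ, IsPartition a b n x → MeshLT n x δ →
    (∀ k < n, t k ∈ Set.Icc (x k) (x (k + 1))) →
    |RiemannSum f n x t - L| < ε

/-- `f` is right-endpoint Riemann integrable on `[a,b]` with value `L`. -/
def RightEndpointIntegrableWith (a b : ℝ) (f : ℝ → ℝ) (L : ℝ) : Prop :=
  ∀ ε > 0, ∃ δ > 0, ∀ n : ℕ, ∀ x : ℕ → ℝ, IsPartition a b n x → MeshLT n x δ →
    |RiemannSum f n x (fun k => x (k + 1)) - L| < ε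

/-- Repeated points of a weakly increasing partition can be removed without changing its
right-endpoint sum. -/
lemma exists_strict_partition (f : ℝ → ℝ) {δ : ℝ} (n : ℕ) (x : ℕ → ℝ)
    (hx : ∀ k < n, x k ≤ x (k + 1)) (hδ : MeshLT n x δ) :
    ∃ (m : ℕ) (y : ℕ → ℝ), y 0 = x 0 ∧ y m = x n ∧ (∀ k < m, y k < y (k + 1)) ∧
      MeshLT m y δ ∧
      RiemannSum f m y (fun k => y (k + 1)) = RiemannSum f n x (fun k => x (k + 1)) := by
  induction n with
  | zero => exact ⟨0, x, rfl, rfl, by simp, by simp [MeshLT], by simp [RiemannSum]⟩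
  | succ n ih =>
    obtain ⟨m, y, h0, hm, hy, hyδ, hsum⟩ :=
      ih (fun k hk => hx k (by omega)) (fun k hk => hδ k (by omega))
    rcases (hx n (by omega)).eq_or_lt with heq | hlt
    · refine ⟨m, y, h0, hm.trans heq, hy, hyδ, ?_⟩
      rw [hsum]
      simp [RiemannSum, Finset.sum_range_succ, heq]
    · have hupd : ∀ k ≤ m, Function.update y (m + 1) (x (n + 1)) k = y k := fun k hk =>
        Function.update_of_ne (by omega) _ _
      have hlast : Function.update y (m + 1) (x (n + 1)) (m + 1) = x (n + 1) :=
        Function.update_self _ _ _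
      refine ⟨m + 1, Function.update y (m + 1) (x (n + 1)), ?_, hlast, ?_, ?_, ?_⟩
      · rw [hupd 0 (by omega), h0]
      · intro k hk
        rcases (Nat.lt_succ_iff.mp hk).eq_or_lt with rfl | hk'
        · rwa [hlast, hupd k le_rfl, hm]
        · rw [hupd k hk'.le, hupd (k + 1) hk']
          exact hy k hk'
      · intro k hk
        rcases (Nat.lt_succ_iff.mp hk).eq_or_lt with rfl | hk'
        · rw [hlast, hupd k le_rfl, hm]
          exact hδ n (by omega)
        · rw [hupd k hk'.le, hupd (k + 1) hk']
          exact hyδ k hk'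
      · have hpre : ∑ k ∈ Finset.range m,
            f (Function.update y (m + 1) (x (n + 1)) (k + 1)) *
              (Function.update y (m + 1) (x (n + 1)) (k + 1) -
                Function.update y (m + 1) (x (n + 1)) k) =
            ∑ k ∈ Finset.range m, f (y (k + 1)) * (y (k + 1) - y k) := by
          refine Finset.sum_congr rfl fun k hk => ?_
          have hk' := Finset.mem_range.mp hk
          rw [hupd k hk'.le, hupd (k + 1) hk']
        simp only [RiemannSum] at hsum ⊢
        rw [Finset.sum_range_succ, Finset.sum_range_succ, hpre, hsum, hlast, hupd m le_rfl, hm]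

lemma abs_rightEndpoint_sub_lt_of_weak {a b : ℝ} (hab : a < b) {f : ℝ → ℝ} {L ε δ : ℝ}
    (h : ∀ n : ℕ, ∀ x : ℕ → ℝ, IsPartition a b n x → MeshLT n x δ →
      |RiemannSum f n x (fun k => x (k + 1)) - L| < ε)
    (n : ℕ) (x : ℕ → ℝ) (h0 : x 0 = a) (hn : x n = b)
    (hx : ∀ k < n, x k ≤ x (k + 1)) (hδ : MeshLT n x δ) :
    |RiemannSum f n x (fun k => x (k + 1)) - L| < ε := by
  obtain ⟨m, y, hy0, hym, hy, hyδ, hsum⟩ := exists_strict_partition f n x hx hδ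
  rw [← hsum]
  refine h m y ⟨Nat.pos_of_ne_zero ?_, hy0.trans h0, hym.trans hn, hy⟩ hyδ
  rintro rfl
  linarith

lemma sum_range_three_mul (g : ℕ → ℝ) (m : ℕ) :
    ∑ k ∈ Finset.range (3 * m), g k =
      ∑ i ∈ Finset.range m, (g (3 * i) + g (3 * i + 1) + g (3 * i + 2)) := by
  induction m with
  | zero => simp
  | succ m ih =>
    rw [Finset.sum_range_succ, ← ih, show 3 * (m + 1) = 3 * m + 1 + 1 + 1 by ring,
      Finset.sum_range_succ, Finset.sum_range_succ, Finset.sum_range_succ]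
    ring

/-- The sequence `p 0, s 0, r 0, p 1, s 1, r 1, ...`. -/
noncomputable def interleave (p s r : ℕ → ℝ) (k : ℕ) : ℝ :=
  if k % 3 = 0 then p (k / 3) else if k % 3 = 1 then s (k / 3) else r (k / 3)

lemma interleave_three_mul (p s r : ℕ → ℝ) (i : ℕ) : interleave p s r (3 * i) = p i := by
  simp [interleave]

lemma interleave_three_mul_add_one (p s r : ℕ → ℝ) (i : ℕ) :
    interleave p s r (3 * i + 1) = s i := by
  have h1 : (3 * i + 1) % 3 = 1 := by omega
  have h2 : (3 * i + 1) / 3 = i := by omega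
  simp [interleave, h1, h2]

lemma interleave_three_mul_add_two (p s r : ℕ → ℝ) (i : ℕ) :
    interleave p s r (3 * i + 2) = r i := by
  have h1 : (3 * i + 2) % 3 = 2 := by omega
  have h2 : (3 * i + 2) / 3 = i := by omega
  simp [interleave, h1, h2]

lemma interleave_three_mul_add_three (p s r : ℕ → ℝ) (i : ℕ) :
    interleave p s r (3 * i + 2 + 1) = p (i + 1) :=
  interleave_three_mul p s r (i + 1)

lemma abs_interleaved_sum_sub_lt {a b : ℝ} (hab : a < b) {f : ℝ → ℝ} {L ε δ : ℝ}
    (h : ∀ n : ℕ, ∀ x : ℕ → ℝ, IsPartition a b n x → MeshLT n x δ →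
      |RiemannSum f n x (fun k => x (k + 1)) - L| < ε)
    (m : ℕ) (p s r : ℕ → ℝ) (h0 : p 0 = a) (hm : p m = b)
    (hps : ∀ i, p i ≤ s i) (hsr : ∀ i, s i ≤ r i) (hrp : ∀ i, r i ≤ p (i + 1))
    (hδ : ∀ i, p (i + 1) - p i < δ) :
    |∑ i ∈ Finset.range m, (f (s i) * (s i - p i) + f (r i) * (r i - s i) +
      f (p (i + 1)) * (p (i + 1) - r i)) - L| < ε := by
  have key : ∀ k, interleave p s r k ≤ interleave p s r (k + 1) ∧
      interleave p s r (k + 1) - interleave p s r k < δ := by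
    intro k
    have hk : k = 3 * (k / 3) ∨ k = 3 * (k / 3) + 1 ∨ k = 3 * (k / 3) + 2 := by omega
    generalize k / 3 = i at hk
    have := hps i
    have := hsr i
    have := hrp i
    have := hδ i
    rcases hk with rfl | rfl | rfl
    · rw [interleave_three_mul, interleave_three_mul_add_one]
      constructor <;> linarith
    · rw [interleave_three_mul_add_one, interleave_three_mul_add_two]
      constructor <;> linarith
    · rw [interleave_three_mul_add_two, interleave_three_mul_add_three]
      constructor <;> linarith
  have hw := abs_rightEndpoint_sub_lt_of_weak hab h (3 * m) (interleave p s r)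
    ((interleave_three_mul p s r 0).trans h0) ((interleave_three_mul p s r m).trans hm)
    (fun k _ => (key k).1) (fun k _ => (key k).2)
  simpa only [RiemannSum, sum_range_three_mul, interleave_three_mul,
    interleave_three_mul_add_one, interleave_three_mul_add_two,
    interleave_three_mul_add_three] using hw

/-- Inserting `s i` between `p i` and `r i` changes the right-endpoint sum by
`(f (s i) - f (r i)) * (s i - p i)`. -/
lemma sum_abs_sub_mul_lt {a b : ℝ} (hab : a < b) {f : ℝ → ℝ} {L ε δ : ℝ}
    (h : ∀ n : ℕ, ∀ x : ℕ → ℝ, IsPartition a b n x → MeshLT n x δ →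
      |RiemannSum f n x (fun k => x (k + 1)) - L| < ε)
    (m : ℕ) (p s r : ℕ → ℝ) (h0 : p 0 = a) (hm : p m = b)
    (hps : ∀ i, p i ≤ s i) (hsr : ∀ i, s i ≤ r i) (hrp : ∀ i, r i ≤ p (i + 1))
    (hδ : ∀ i, p (i + 1) - p i < δ) :
    ∑ i ∈ Finset.range m, |f (s i) - f (r i)| * (s i - p i) < 2 * ε := by
  have hpos := abs_interleaved_sum_sub_lt hab h m p
    (fun i => if f (r i) ≤ f (s i) then s i else p i) r h0 hm
    (fun i => by split_ifs <;> linarith [hps i])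
    (fun i => by split_ifs <;> linarith [hps i, hsr i]) hrp hδ
  have hneg := abs_interleaved_sum_sub_lt hab h m p
    (fun i => if f (r i) ≤ f (s i) then p i else s i) r h0 hm
    (fun i => by split_ifs <;> linarith [hps i])
    (fun i => by split_ifs <;> linarith [hps i, hsr i]) hrp hδ
  rw [abs_lt] at hpos hneg
  refine lt_of_eq_of_lt ?_
    ((sub_lt_sub hpos.2 hneg.1).trans_eq (by ring : ε - -ε = 2 * ε))
  rw [sub_sub_sub_cancel_right, ← Finset.sum_sub_distrib]
  refine Finset.sum_congr rfl fun i _ => ?_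
  split_ifs with hi
  · rw [abs_of_nonneg (by linarith)]
    ring
  · rw [abs_of_neg (by linarith)]
    ring

lemma exists_almost_max_oscillation {A B K η : ℝ} (hAB : A ≤ B) (hη : 0 < η) (f : ℝ → ℝ)
    (hK : ∀ y ∈ Set.Icc A B, |f y| ≤ K) :
    ∃ s r, A ≤ s ∧ s ≤ r ∧ r ≤ B ∧
      ∀ u ∈ Set.Icc A B, ∀ v ∈ Set.Icc A B, |f u - f v| ≤ |f s - f r| + η := by
  set O : Set ℝ := (fun q : ℝ × ℝ => |f q.1 - f q.2|) '' (Set.Icc A B ×ˢ Set.Icc A B)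
  have hne : O.Nonempty :=
    ⟨_, (A, A), ⟨⟨le_rfl, hAB⟩, ⟨le_rfl, hAB⟩⟩, rfl⟩
  have hbdd : BddAbove O := by
    refine ⟨K + K, ?_⟩
    rintro _ ⟨q, hq, rfl⟩
    exact (abs_sub _ _).trans (add_le_add (hK _ hq.1) (hK _ hq.2))
  obtain ⟨_, ⟨⟨s, r⟩, ⟨hs, hr⟩, rfl⟩, hsr⟩ :=
    exists_lt_of_lt_csSup hne (sub_lt_self (sSup O) hη)
  have hmax : ∀ u ∈ Set.Icc A B, ∀ v ∈ Set.Icc A B, |f u - f v| ≤ |f s - f r| + η := by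
    intro u hu v hv
    have := le_csSup hbdd (⟨(u, v), ⟨hu, hv⟩, rfl⟩ : |f u - f v| ∈ O)
    dsimp only at hsr
    linarith
  rcases le_total s r with hle | hle
  · exact ⟨s, r, hs.1, hle, hr.2, hmax⟩
  · refine ⟨r, s, hr.1, hle, hs.2, ?_⟩
    rwa [abs_sub_comm (f r)]

/-- Non-overlapping intervals contained in `[A, B]` have total length at most `B - A`. -/
lemma sum_sub_le_of_subset_Icc {A B : ℝ} (hAB : A ≤ B) {n : ℕ} {x : ℕ → ℝ}
    (hx : ∀ k < n, x k ≤ x (k + 1)) (S : Finset ℕ) (hS : S ⊆ Finset.range n)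
    (hA : ∀ k ∈ S, A ≤ x k) (hB : ∀ k ∈ S, x (k + 1) ≤ B) :
    ∑ k ∈ S, (x (k + 1) - x k) ≤ B - A := by
  have hmono : Monotone fun u : ℝ => max A (min B u) := fun u v huv =>
    max_le_max le_rfl (min_le_min le_rfl huv)
  calc ∑ k ∈ S, (x (k + 1) - x k)
      = ∑ k ∈ S, (max A (min B (x (k + 1))) - max A (min B (x k))) := by
        refine Finset.sum_congr rfl fun k hk => ?_
        have h1 := hA k hk
        have h2 := hB k hk
        have h3 := hx k (Finset.mem_range.mp (hS hk))
        rw [min_eq_right h2, min_eq_right (h3.trans h2), max_eq_right h1,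
          max_eq_right (h1.trans h3)]
    _ ≤ ∑ k ∈ Finset.range n, (max A (min B (x (k + 1))) - max A (min B (x k))) :=
        Finset.sum_le_sum_of_subset_of_nonneg hS fun k hk _ =>
          sub_nonneg.mpr (hmono (hx k (Finset.mem_range.mp hk)))
    _ = max A (min B (x n)) - max A (min B (x 0)) :=
        Finset.sum_range_sub (fun k => max A (min B (x k))) n
    _ ≤ B - A := sub_le_sub (max_le hAB (min_le_left _ _)) (le_max_left _ _)

/-- The grid point `a + (j - 3) * h`, clipped to `[a, b]`. -/
noncomputable def gridPoint (a b h : ℝ) (j : ℕ) : ℝ :=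
  max a (min b (a + ((j : ℝ) - 3) * h))

lemma gridPoint_mono {a b h : ℝ} (hh : 0 ≤ h) : Monotone (gridPoint a b h) := by
  intro i j hij
  have : (i : ℝ) ≤ j := by exact_mod_cast hij
  unfold gridPoint
  gcongr

lemma gridPoint_mem_Icc {a b : ℝ} (hab : a ≤ b) (h : ℝ) (j : ℕ) :
    gridPoint a b h j ∈ Set.Icc a b :=
  ⟨le_max_left _ _, max_le hab (min_le_left _ _)⟩

lemma gridPoint_eq_left {a b h : ℝ} (hh : 0 ≤ h) {j : ℕ} (hj : j ≤ 3) :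
    gridPoint a b h j = a := by
  have : (j : ℝ) ≤ 3 := by exact_mod_cast hj
  exact max_eq_left ((min_le_right _ _).trans (by nlinarith))

lemma gridPoint_eq_right {a b h : ℝ} (hab : a ≤ b) {j : ℕ}
    (hj : b ≤ a + ((j : ℝ) - 3) * h) : gridPoint a b h j = b := by
  rw [gridPoint, min_eq_left hj, max_eq_right hab]

lemma gridPoint_add_three {a b h : ℝ} {i : ℕ} (hh : 0 ≤ h) (hi : a + i * h ≤ b) :
    gridPoint a b h (i + 3) = a + i * h := by
  have : 0 ≤ (i : ℝ) * h := by positivity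
  rw [gridPoint]
  push_cast
  rw [add_sub_cancel_right, min_eq_right hi, max_eq_right (by linarith)]

lemma gridPoint_sub_le {a b h : ℝ} (hh : 0 ≤ h) (j d : ℕ) :
    gridPoint a b h (j + d) - gridPoint a b h j ≤ d * h := by
  have hd : 0 ≤ (d : ℝ) * h := by positivity
  rw [sub_le_iff_le_add]
  unfold gridPoint
  push_cast
  refine max_le (by linarith [le_max_left a (min b (a + ((j : ℝ) - 3) * h))]) ?_
  rw [← sub_le_iff_le_add']
  refine le_trans ?_ (le_max_right _ _)
  refine le_min (by linarith [min_le_left b (a + ((j : ℝ) + d - 3) * h)]) ?_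
  linarith [min_le_right b (a + ((j : ℝ) + d - 3) * h)]

/-- The oscillations over all cells `[gridPoint (j + 1), gridPoint (j + 3)]`, weighted by the
distance to the preceding grid point, are controlled by splitting the cells into three families
of non-overlapping ones. -/
lemma sum_grid_oscillation_lt {a b : ℝ} (hab : a < b) {f : ℝ → ℝ} {L ε δ h : ℝ}
    (hf : ∀ n : ℕ, ∀ x : ℕ → ℝ, IsPartition a b n x → MeshLT n x δ →
      |RiemannSum f n x (fun k => x (k + 1)) - L| < ε)
    (hh : 0 < h) (hhδ : 3 * h < δ) (s r : ℕ → ℝ)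
    (hs : ∀ j, gridPoint a b h (j + 1) ≤ s j) (hsr : ∀ j, s j ≤ r j)
    (hr : ∀ j, r j ≤ gridPoint a b h (j + 3)) (m : ℕ)
    (hm : b ≤ a + (3 * (m : ℝ) - 3) * h) :
    ∑ j ∈ Finset.range (3 * m), |f (s j) - f (r j)| * (s j - gridPoint a b h j) < 6 * ε := by
  have key : ∀ c ≤ 2, ∑ i ∈ Finset.range m, |f (s (3 * i + c)) - f (r (3 * i + c))| *
      (s (3 * i + c) - gridPoint a b h (3 * i + c)) < 2 * ε := by
    intro c hc
    have hnext : ∀ i, 3 * (i + 1) + c = 3 * i + c + 3 := fun i => by ring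
    refine sum_abs_sub_mul_lt hab hf m (fun i => gridPoint a b h (3 * i + c))
      (fun i => s (3 * i + c)) (fun i => r (3 * i + c)) ?_ ?_ ?_ (fun i => hsr _) ?_ ?_
    · exact gridPoint_eq_left hh.le (by omega)
    · refine gridPoint_eq_right hab.le (hm.trans ?_)
      push_cast
      gcongr
      linarith [(Nat.cast_nonneg c : (0 : ℝ) ≤ c)]
    · exact fun i => (gridPoint_mono hh.le (Nat.le_succ _)).trans (hs _)
    · intro i
      rw [hnext]
      exact hr _
    · intro i
      rw [hnext]
      refine (gridPoint_sub_le hh.le _ _).trans_lt ?_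
      exact_mod_cast hhδ
  have h0 := key 0 (by omega)
  have h1 := key 1 (by omega)
  have h2 := key 2 (by omega)
  simp only [add_zero] at h0
  rw [sum_range_three_mul, Finset.sum_add_distrib, Finset.sum_add_distrib]
  linarith

/-- A finer partition has small weighted oscillation: each of its intervals lies in a grid cell. -/
lemma sum_abs_sub_le_of_mesh {a b : ℝ} (hab : a < b) {f : ℝ → ℝ} {L ε δ h K : ℝ}
    (hε : 0 < ε)
    (hf : ∀ n : ℕ, ∀ x : ℕ → ℝ, IsPartition a b n x → MeshLT n x δ →
      |RiemannSum f n x (fun k => x (k + 1)) - L| < ε)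
    (hK : ∀ y ∈ Set.Icc a b, |f y| ≤ K)
    (hh : 0 < h) (hhδ : 3 * h < δ) (hKh : 4 * K * h ≤ ε)
    (n : ℕ) (x t : ℕ → ℝ) (hx : IsPartition a b n x) (hmesh : MeshLT n x h)
    (ht : ∀ k < n, t k ∈ Set.Icc (x k) (x (k + 1))) :
    ∑ k ∈ Finset.range n, |f (t k) - f (x (k + 1))| * (x (k + 1) - x k) ≤
      ε * (b - a) + 12 * ε + ε := by
  obtain ⟨-, hx0, hxn, hlt⟩ := hx
  have hsub : ∀ j, Set.Icc (gridPoint a b h (j + 1)) (gridPoint a b h (j + 3)) ⊆ Set.Icc a b :=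
    fun j => Set.Icc_subset_Icc (gridPoint_mem_Icc hab.le h _).1 (gridPoint_mem_Icc hab.le h _).2
  have hosc := fun j => exists_almost_max_oscillation
    (gridPoint_mono (a := a) (b := b) hh.le (show j + 1 ≤ j + 3 by omega)) hε f
    (fun y hy => hK y (hsub j hy))
  choose s r hs hsr hr hmax using hosc
  obtain ⟨m, hm⟩ := exists_nat_ge ((b - a) / h + 1)
  have hquot : 0 ≤ (b - a) / h := div_nonneg (by linarith) hh.le
  have hm3 : (b - a) / h ≤ 3 * (m : ℝ) - 3 := by linarith
  have hgrid := sum_grid_oscillation_lt hab hf hh hhδ s r hs hsr hr m (by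
    rw [div_le_iff₀ hh] at hm3
    linarith)
  have hxle : ∀ k < n, x k ≤ x (k + 1) := fun k hk => (hlt k hk).le
  have hax : ∀ k ≤ n, a ≤ x k := by
    intro k
    induction k with
    | zero => exact fun _ => hx0.ge
    | succ k ih => exact fun hk => (ih (by omega)).trans (hxle k hk)
  have hxb : ∀ k ≤ n, x k ≤ b := fun k hk =>
    Nat.decreasingInduction (motive := fun k _ => x k ≤ b)
      (fun k hk ih => (hxle k hk).trans ih) hxn.le hk
  set q : ℕ → ℕ := fun k => ⌊(x k - a) / h⌋₊
  have hq_le : ∀ k ≤ n, a + q k * h ≤ x k := by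
    intro k hk
    have := Nat.floor_le (div_nonneg (sub_nonneg.mpr (hax k hk)) hh.le)
    rw [le_div_iff₀ hh] at this
    linarith
  have hq_lt : ∀ k, x k < a + (q k + 1) * h := by
    intro k
    have := Nat.lt_floor_add_one ((x k - a) / h)
    rw [div_lt_iff₀ hh] at this
    linarith
  have hcellL : ∀ k < n, gridPoint a b h (q k + 2 + 1) ≤ x k := by
    intro k hk
    have := hq_le k hk.le
    rw [gridPoint_add_three hh.le (this.trans (hxb k hk.le))]
    exact this
  have hcellR : ∀ k < n, x (k + 1) ≤ gridPoint a b h (q k + 2 + 3) := by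
    intro k hk
    refine le_trans (le_min (hxb (k + 1) hk) ?_) (le_max_right _ _)
    have h1 := hmesh k hk
    have h2 := hq_lt k
    push_cast
    linarith
  have hmaps : ∀ k ∈ Finset.range n, q k + 2 ∈ Finset.range (3 * m) := by
    intro k hk
    have hk' := (Finset.mem_range.mp hk).le
    have h1 := hq_le k hk'
    have h2 := hxb k hk'
    have h3 : (q k : ℝ) ≤ (b - a) / h := by
      rw [le_div_iff₀ hh]
      linarith
    have h4 : (q k : ℝ) + 3 ≤ 3 * m := by linarith
    have h5 : q k + 3 ≤ 3 * m := by exact_mod_cast h4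
    exact Finset.mem_range.mpr (by omega)
  set Λ : ℕ → ℝ := fun j => ∑ k ∈ Finset.range n with q k + 2 = j, (x (k + 1) - x k) with hΛ
  have hK0 : 0 ≤ K := (abs_nonneg _).trans (hK a ⟨le_rfl, hab.le⟩)
  have hΛ0 : ∀ j, 0 ≤ Λ j := fun j => Finset.sum_nonneg fun k hk =>
    sub_nonneg.mpr (hxle k (Finset.mem_range.mp (Finset.mem_filter.mp hk).1))
  have hΛle : ∀ j, Λ j ≤ 2 * h := by
    intro j
    refine (sum_sub_le_of_subset_Icc (A := gridPoint a b h (j + 1))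
      (B := gridPoint a b h (j + 1 + 2)) (gridPoint_mono hh.le (by omega)) hxle _
      (Finset.filter_subset _ _) ?_ ?_).trans (by exact_mod_cast gridPoint_sub_le hh.le (j + 1) 2)
    · intro k hk
      obtain ⟨hk1, rfl⟩ := Finset.mem_filter.mp hk
      exact hcellL k (Finset.mem_range.mp hk1)
    · intro k hk
      obtain ⟨hk1, rfl⟩ := Finset.mem_filter.mp hk
      exact hcellR k (Finset.mem_range.mp hk1)
  have hΛsum : ∑ j ∈ Finset.range (3 * m), Λ j = b - a := by
    rw [hΛ, Finset.sum_fiberwise_of_maps_to hmaps, Finset.sum_range_sub, hx0, hxn]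
  have hweight : ∀ j, 0 ≤ s j - gridPoint a b h j := fun j =>
    sub_nonneg.mpr ((gridPoint_mono hh.le (Nat.le_succ j)).trans (hs j))
  have hΔ : ∀ j, |f (s j) - f (r j)| * Λ j ≤
      2 * (|f (s j) - f (r j)| * (s j - gridPoint a b h j)) + if j = 2 then ε else 0 := by
    intro j
    have hnn := abs_nonneg (f (s j) - f (r j))
    split_ifs with hj
    · have h1 : |f (s j) - f (r j)| ≤ 2 * K := by
        have h2 := hK _ (hsub j ⟨hs j, (hsr j).trans (hr j)⟩)
        have h3 := hK _ (hsub j ⟨(hs j).trans (hsr j), hr j⟩)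
        linarith [abs_sub (f (s j)) (f (r j))]
      have h2 := mul_le_mul h1 (hΛle j) (hΛ0 j) (by positivity)
      have h3 := mul_nonneg hnn (hweight j)
      linarith
    · rcases (Finset.range n |>.filter fun k => q k + 2 = j).eq_empty_or_nonempty with he | hne
      · have : Λ j = 0 := by simp only [hΛ, he, Finset.sum_empty]
        rw [this]
        have := mul_nonneg hnn (hweight j)
        linarith
      · obtain ⟨k, hk⟩ := hne
        obtain ⟨hk1, rfl⟩ := Finset.mem_filter.mp hk
        have hkn := (Finset.mem_range.mp hk1).le
        obtain ⟨i, hi⟩ : ∃ i, q k = i + 1 := Nat.exists_eq_succ_of_ne_zero (by omega)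
        have h1 := (hq_le k hkn).trans (hxb k hkn)
        have h2 := hs (q k + 2)
        have h3 : gridPoint a b h (q k + 2) = a + i * h := by
          rw [hi] at h1 ⊢
          push_cast at h1
          exact gridPoint_add_three hh.le (by linarith)
        rw [gridPoint_add_three hh.le h1] at h2
        have h4 : Λ (q k + 2) ≤ 2 * (s (q k + 2) - gridPoint a b h (q k + 2)) := by
          refine (hΛle _).trans ?_
          rw [h3]
          rw [hi] at h2 ⊢
          push_cast at h2
          linarith
        have := mul_le_mul_of_nonneg_left h4 hnn
        linarith
  calc ∑ k ∈ Finset.range n, |f (t k) - f (x (k + 1))| * (x (k + 1) - x k)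
      = ∑ j ∈ Finset.range (3 * m), ∑ k ∈ Finset.range n with q k + 2 = j,
          |f (t k) - f (x (k + 1))| * (x (k + 1) - x k) :=
        (Finset.sum_fiberwise_of_maps_to hmaps _).symm
    _ ≤ ∑ j ∈ Finset.range (3 * m), (|f (s j) - f (r j)| + ε) * Λ j := by
        refine Finset.sum_le_sum fun j _ => ?_
        rw [hΛ, Finset.mul_sum]
        refine Finset.sum_le_sum fun k hk => ?_
        obtain ⟨hk1, rfl⟩ := Finset.mem_filter.mp hk
        have hkn := Finset.mem_range.mp hk1
        have h1 := hcellL k hkn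
        have h2 := hcellR k hkn
        have h3 := ht k hkn
        refine mul_le_mul_of_nonneg_right (hmax _ _ ⟨h1.trans h3.1, h3.2.trans h2⟩ _
          ⟨h1.trans (hxle k hkn), h2⟩) (sub_nonneg.mpr (hxle k hkn))
    _ ≤ ∑ j ∈ Finset.range (3 * m), (ε * Λ j +
          2 * (|f (s j) - f (r j)| * (s j - gridPoint a b h j)) + if j = 2 then ε else 0) := by
        refine Finset.sum_le_sum fun j _ => ?_
        linarith [hΔ j]
    _ ≤ ε * (b - a) + 12 * ε + ε := by
        rw [Finset.sum_add_distrib, Finset.sum_add_distrib, ← Finset.mul_sum, ← Finset.mul_sum,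
          hΛsum, Finset.sum_ite_eq']
        split_ifs <;> linarith

/-- A bounded right-endpoint Riemann integrable function on `[a,b]` is Riemann
integrable on `[a,b]`, with the same value of the integral. -/
theorem riemann_of_rightEndpoint (a b : ℝ) (hab : a < b) (f : ℝ → ℝ)
    (hbd : ∃ M : ℝ, ∀ y ∈ Set.Icc a b, |f y| ≤ M) (L : ℝ)
    (hf : RightEndpointIntegrableWith a b f L) :
    RiemannIntegrableWith a b f L := by
  intro ε hε
  obtain ⟨K, hK⟩ := hbd
  have hK0 : 0 ≤ K := (abs_nonneg _).trans (hK a ⟨le_rfl, hab.le⟩)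
  have hC : 0 < b - a + 14 := by linarith
  set η := ε / (b - a + 14)
  have hη0 : 0 < η := div_pos hε hC
  have hηε : η * (b - a + 14) = ε := div_mul_cancel₀ ε hC.ne'
  obtain ⟨δ, hδ, hfδ⟩ := hf η hη0
  set h := min (δ / 4) (η / (4 * K + 1))
  have hh0 : 0 < h := lt_min (by positivity) (by positivity)
  have hh1 : h ≤ δ / 4 := min_le_left _ _
  have hh2 : h * (4 * K + 1) ≤ η := (le_div_iff₀ (by positivity)).mp (min_le_right _ _)
  refine ⟨h, hh0, fun n x t hx hmesh ht => ?_⟩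
  have hbound := sum_abs_sub_le_of_mesh hab hη0 hfδ hK hh0 (by linarith) (by linarith)
    n x t hx hmesh ht
  have hright := hfδ n x hx fun k hk => (hmesh k hk).trans_le (by linarith)
  have hdiff : |RiemannSum f n x t - RiemannSum f n x (fun k => x (k + 1))| ≤
      ∑ k ∈ Finset.range n, |f (t k) - f (x (k + 1))| * (x (k + 1) - x k) := by
    rw [RiemannSum, RiemannSum, ← Finset.sum_sub_distrib]
    refine (Finset.abs_sum_le_sum_abs _ _).trans (Finset.sum_le_sum fun k hk => ?_)
    rw [← sub_mul, abs_mul,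
      abs_of_pos (sub_pos.mpr (hx.2.2.2 k (Finset.mem_range.mp hk)))]
  have htri := abs_sub_le (RiemannSum f n x t) (RiemannSum f n x (fun k => x (k + 1))) L
  linarith
end

section
/- If f : [a,b] → ℝ is right-endpoint Riemann integrable on [a,b] with limiting value L, then f is Riemann integrable on [c,b] for every a < c < b, and the limit as c → a⁺ of ∫_c^b f(x) dx equals L. -/
open Finset Set Filter

/-- `RightSum f δ u v S`: `S` is the right-endpoint Riemann sum of `f` over some (possibly empty)
subdivision of `[u,v]` all of whose steps are shorter than `δ`. -/
inductive RightSum (f : ℝ → ℝ) (δ u : ℝ) : ℝ → ℝ → Prop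
  | nil : RightSum f δ u u 0
  | snoc {v w S : ℝ} : RightSum f δ u v S → v < w → w - v < δ →
      RightSum f δ u w (S + f w * (w - v))

namespace RightSum

variable {f : ℝ → ℝ} {δ u v w S T : ℝ}

theorem step (huv : u ≤ v) (h : v - u < δ) : RightSum f δ u v (f v * (v - u)) := by
  rcases huv.eq_or_lt with rfl | huv
  · simpa using RightSum.nil (f := f) (δ := δ) (u := u)
  · simpa using RightSum.nil.snoc huv h

theorem trans (hS : RightSum f δ u v S) (hT : RightSum f δ v w T) :
    RightSum f δ u w (S + T) := by
  induction hT with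
  | nil => simpa using hS
  | snoc _ h1 h2 ih =>
    rw [← add_assoc]
    exact ih.snoc h1 h2

/-- A right-endpoint sum is the Riemann sum of an indexed subdivision. -/
theorem exists_sequence (hS : RightSum f δ u v S) :
    ∃ n : ℕ, ∃ x : ℕ → ℝ, x 0 = u ∧ x n = v ∧ (∀ k < n, x k < x (k + 1)) ∧ MeshLT n x δ ∧
      RiemannSum f n x (fun k => x (k + 1)) = S := by
  induction hS with
  | nil => exact ⟨0, fun _ => u, rfl, rfl, by simp, by simp [MeshLT], by simp [RiemannSum]⟩
  | @snoc v w S _ h1 h2 ih =>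
    obtain ⟨n, x, h0, hn, hlt, hm, hs⟩ := ih
    have hx : ∀ k ≤ n, (if k ≤ n then x k else w) = x k := fun k hk => if_pos hk
    have hw : (if n + 1 ≤ n then x (n + 1) else w) = w := if_neg (by omega)
    refine ⟨n + 1, fun k => if k ≤ n then x k else w, ?_, hw, ?_, ?_, ?_⟩
    · simpa using h0
    · intro k hk
      rcases (Nat.lt_succ_iff_lt_or_eq.mp hk) with hk | rfl
      · simpa only [hx k hk.le, hx (k + 1) hk] using hlt k hk
      · simpa only [hw, hn, le_refl, if_true] using h1
    · intro k hk
      rcases (Nat.lt_succ_iff_lt_or_eq.mp hk) with hk | rfl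
      · simpa only [hx k hk.le, hx (k + 1) hk] using hm k hk
      · simpa only [hw, hn, le_refl, if_true] using h2
    · unfold RiemannSum at hs ⊢
      rw [Finset.sum_range_succ, ← hs]
      simp only [hw, hn, le_refl, if_true]
      congr 1
      refine Finset.sum_congr rfl fun k hk => ?_
      have hk := Finset.mem_range.mp hk
      rw [hx k hk.le, hx (k + 1) hk]

end RightSum

theorem rightSum_of_sequence {f : ℝ → ℝ} {δ : ℝ} {n : ℕ} {x : ℕ → ℝ}
    (hlt : ∀ k < n, x k < x (k + 1)) (hm : MeshLT n x δ) :
    RightSum f δ (x 0) (x n) (RiemannSum f n x (fun k => x (k + 1))) := by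
  induction n with
  | zero => simpa [RiemannSum] using RightSum.nil
  | succ n ih =>
    unfold RiemannSum
    rw [Finset.sum_range_succ]
    exact (ih (fun k hk => hlt k (by omega)) (fun k hk => hm k (by omega))).snoc
      (hlt n (by omega)) (hm n (by omega))

/-- The `n`-step uniform subdivision of `[u,v]`. -/
noncomputable def uniformPoint (u v : ℝ) (n k : ℕ) : ℝ := u + k * ((v - u) / n)

theorem uniformPoint_succ_sub (u v : ℝ) (n k : ℕ) :
    uniformPoint u v n (k + 1) - uniformPoint u v n k = (v - u) / n := by
  unfold uniformPoint
  push_cast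
  ring

theorem isPartition_uniformPoint {u v : ℝ} (huv : u < v) {n : ℕ} (hn : 0 < n) :
    IsPartition u v n (uniformPoint u v n) := by
  have hn' : (0 : ℝ) < n := by exact_mod_cast hn
  refine ⟨hn, by simp [uniformPoint], ?_, fun k _ => ?_⟩
  · unfold uniformPoint
    field_simp
    ring
  · rw [← sub_pos, uniformPoint_succ_sub]
    exact div_pos (sub_pos.mpr huv) hn'

theorem meshLT_uniformPoint {u v δ : ℝ} {n : ℕ} (h : (v - u) / n < δ) :
    MeshLT n (uniformPoint u v n) δ :=
  fun k _ => by rwa [uniformPoint_succ_sub]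

theorem eventually_div_natCast_lt (r : ℝ) {δ : ℝ} (hδ : 0 < δ) :
    ∀ᶠ n : ℕ in atTop, r / n < δ :=
  (tendsto_const_div_atTop_nhds_zero_nat r).eventually_lt_const hδ

theorem exists_rightSum (f : ℝ → ℝ) {δ u v : ℝ} (hδ : 0 < δ) (huv : u ≤ v) :
    ∃ S, RightSum f δ u v S := by
  rcases huv.eq_or_lt with rfl | huv
  · exact ⟨0, RightSum.nil⟩
  obtain ⟨n, hn, hn0⟩ :=
    ((eventually_div_natCast_lt (v - u) hδ).and (eventually_gt_atTop 0)).exists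
  obtain ⟨-, h0, h1, hlt⟩ := isPartition_uniformPoint huv hn0
  have := rightSum_of_sequence (f := f) hlt (meshLT_uniformPoint hn)
  rw [h0, h1] at this
  exact ⟨_, this⟩

theorem RightEndpointIntegrableWith.exists_rightSum_lt {a b L : ℝ} {f : ℝ → ℝ} (hab : a < b)
    (hf : RightEndpointIntegrableWith a b f L) {ε : ℝ} (hε : 0 < ε) :
    ∃ δ > 0, ∀ S, RightSum f δ a b S → |S - L| < ε := by
  obtain ⟨δ, hδ, H⟩ := hf ε hε
  refine ⟨δ, hδ, fun S hS => ?_⟩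
  obtain ⟨n, x, h0, hn, hlt, hm, rfl⟩ := hS.exists_sequence
  refine H n x ⟨Nat.pos_of_ne_zero ?_, h0, hn, hlt⟩ hm
  rintro rfl
  exact hab.ne (h0.symm.trans hn)

/-- Over disjoint blocks `[p i - h, q i]`, including or skipping `p i` as a subdivision point
changes the right-endpoint sum by `(f (p i) - f (q i)) * h`. -/
theorem exists_rightSum_sub_eq {f : ℝ → ℝ} {δ h a : ℝ} (hδ : 0 < δ) (hh : 0 ≤ h)
    (p q : ℕ → ℝ) (m : ℕ) (hpq : ∀ i < m, p i ≤ q i) (hlen : ∀ i < m, q i - p i + h < δ)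
    (ha : ∀ i < m, a ≤ p i - h) (hsep : ∀ i j, i < j → j < m → q i ≤ p j - h) (b : ℝ)
    (hb : ∀ i < m, q i ≤ b) (hab : a ≤ b) :
    ∃ S T, RightSum f δ a b S ∧ RightSum f δ a b T ∧
      S - T = ∑ i ∈ Finset.range m, |f (p i) - f (q i)| * h := by
  induction m generalizing b with
  | zero =>
    obtain ⟨S, hS⟩ := exists_rightSum f hδ hab
    exact ⟨S, S, hS, hS, by simp⟩
  | succ m ih =>
    obtain ⟨S, T, hS, hT, hST⟩ := ih (fun i hi => hpq i (by omega)) (fun i hi => hlen i (by omega))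
      (fun i hi => ha i (by omega)) (fun i j hij hj => hsep i j hij (by omega)) (p m - h)
      (fun i hi => hsep i m hi (by omega)) (ha m (by omega))
    obtain ⟨R, hR⟩ := exists_rightSum f hδ (hb m (by omega))
    have h1 := hpq m (by omega)
    have h2 := hlen m (by omega)
    have fine : RightSum f δ (p m - h) (q m) (f (p m) * h + f (q m) * (q m - p m)) := by
      have := (RightSum.step (f := f) (δ := δ) (u := p m - h) (v := p m) (by linarith)
        (by linarith)).trans (RightSum.step h1 (by linarith))
      rwa [sub_sub_cancel] at this
    have coarse : RightSum f δ (p m - h) (q m) (f (q m) * (q m - (p m - h))) :=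
      RightSum.step (by linarith) (by linarith)
    rcases le_total (f (q m)) (f (p m)) with hle | hle
    · refine ⟨_, _, (hS.trans fine).trans hR, (hT.trans coarse).trans hR, ?_⟩
      rw [Finset.sum_range_succ, ← hST, abs_of_nonneg (sub_nonneg.mpr hle)]
      ring
    · refine ⟨_, _, (hS.trans coarse).trans hR, (hT.trans fine).trans hR, ?_⟩
      rw [Finset.sum_range_succ, ← hST, abs_of_nonpos (sub_nonpos.mpr hle)]
      ring

theorem sum_range_four_mul (g : ℕ → ℝ) (m : ℕ) :
    ∑ j ∈ Finset.range (4 * m), g j =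
      ∑ r ∈ Finset.range 4, ∑ i ∈ Finset.range m, g (4 * i + r) := by
  induction m with
  | zero => simp
  | succ m ih =>
    rw [show 4 * (m + 1) = 4 * m + 1 + 1 + 1 + 1 by ring]
    simp only [Finset.sum_range_succ, Finset.sum_range_zero] at ih ⊢
    rw [ih]
    ring_nf

/-- Values of `f` near the points of a fine uniform subdivision are close to the values at these
points, on average. -/
theorem sum_abs_sub_le {f : ℝ → ℝ} {a b c L δ ε h : ℝ}
    (H : ∀ S, RightSum f δ a b S → |S - L| < ε) (hab : a ≤ b) (hh : 0 < h) (hδ : 4 * h < δ)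
    (hac : a ≤ c - h) {m : ℕ} (s y : ℕ → ℝ) (hy : ∀ j, y j = c + j * h) (hyb : y (4 * m) = b)
    (hs : ∀ j < 4 * m, s j ∈ Set.Icc c b)
    (hsy : ∀ j < 4 * m, s j ∈ Set.Icc (y j - h) (y (j + 1) + h)) :
    ∑ j ∈ Finset.range (4 * m), |f (s j) - f (y (j + 1))| * h ≤ 8 * ε := by
  have key : ∀ r < 4, ∑ i ∈ Finset.range m, |f (s (4 * i + r)) - f (y (4 * i + r + 1))| * h
      ≤ 2 * ε := by
    intro r hr
    have hmem : ∀ i < m, c ≤ min (s (4 * i + r)) (y (4 * i + r + 1)) ∧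
        c + (4 * i + r - 1) * h ≤ min (s (4 * i + r)) (y (4 * i + r + 1)) ∧
        max (s (4 * i + r)) (y (4 * i + r + 1)) ≤ c + (4 * i + r + 2) * h ∧
        max (s (4 * i + r)) (y (4 * i + r + 1)) ≤ b := by
      intro i hi
      have hj : 4 * i + r < 4 * m := by omega
      obtain ⟨h1, h2⟩ := hs _ hj
      obtain ⟨h3, h4⟩ := hsy _ hj
      have h5 : y (4 * i + r + 1) ≤ b := by
        rw [← hyb, hy, hy]
        have : ((4 * i + r + 1 : ℕ) : ℝ) ≤ (4 * m : ℕ) := by exact_mod_cast hj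
        gcongr
      have h6 : y (4 * i + r + 1) = c + (4 * i + r + 1) * h := by rw [hy]; push_cast; ring
      have h7 : y (4 * i + r) = c + (4 * i + r) * h := by rw [hy]; push_cast; ring
      have h8 : (0 : ℝ) ≤ (4 * i + r) * h := by positivity
      refine ⟨le_min h1 ?_, le_min ?_ ?_, max_le ?_ ?_, max_le h2 h5⟩ <;> linarith
    obtain ⟨S, T, hS, hT, hST⟩ := exists_rightSum_sub_eq (f := f) (δ := δ) (h := h) (a := a)
      (by linarith) hh.le (fun i => min (s (4 * i + r)) (y (4 * i + r + 1)))
      (fun i => max (s (4 * i + r)) (y (4 * i + r + 1))) m (fun i _ => min_le_max)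
      (fun i hi => by
        obtain ⟨-, h2, h3, -⟩ := hmem i hi
        linarith)
      (fun i hi => by
        obtain ⟨h1, -⟩ := hmem i hi
        linarith)
      (fun i j hij hj => by
        obtain ⟨-, -, h3, -⟩ := hmem i (hij.trans hj)
        obtain ⟨-, h2, -, -⟩ := hmem j hj
        have : ((i : ℝ) + 1) * h ≤ j * h := by
          have : (i : ℝ) + 1 ≤ j := by exact_mod_cast hij
          gcongr
        linarith) b (fun i hi => (hmem i hi).2.2.2) hab
    have h1 := abs_lt.mp (H S hS)
    have h2 := abs_lt.mp (H T hT)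
    have : ∀ u v : ℝ, |f (min u v) - f (max u v)| = |f u - f v| := by
      intro u v
      rcases le_total u v with huv | huv
      · simp [huv]
      · simp [huv, abs_sub_comm]
    simp only [this] at hST
    linarith
  rw [sum_range_four_mul]
  calc _ ≤ ∑ r ∈ Finset.range 4, 2 * ε :=
        Finset.sum_le_sum fun r hr => key r (Finset.mem_range.mp hr)
    _ = 8 * ε := by simp; ring

/-- The length of the intersection of `[u,v]` and `[p,q]`. -/
noncomputable def overlap (u v p q : ℝ) : ℝ := max u (min v q) - max u (min v p)

theorem overlap_comm {u v p q : ℝ} (huv : u ≤ v) (hpq : p ≤ q) :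
    overlap u v p q = overlap p q u v := by
  unfold overlap
  grind

theorem overlap_nonneg {u v p q : ℝ} (hpq : p ≤ q) : 0 ≤ overlap u v p q :=
  sub_nonneg.mpr (max_le_max le_rfl (min_le_min le_rfl hpq))

theorem lt_of_overlap_ne_zero {u v p q : ℝ} (huv : u ≤ v) (hpq : p ≤ q)
    (h : overlap u v p q ≠ 0) : u < q ∧ p < v := by
  unfold overlap at h
  grind

theorem sum_overlap {u v c b : ℝ} (hcu : c ≤ u) (huv : u ≤ v) (hvb : v ≤ b) {n : ℕ} {y : ℕ → ℝ}
    (h0 : y 0 = c) (hn : y n = b) :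
    ∑ j ∈ Finset.range n, overlap u v (y j) (y (j + 1)) = v - u := by
  unfold overlap
  rw [Finset.sum_range_sub (fun j => max u (min v (y j))), h0, hn]
  grind

theorem IsPartition.mem_Icc {c b : ℝ} {n : ℕ} {x : ℕ → ℝ} (hx : IsPartition c b n x) {k : ℕ}
    (hk : k ≤ n) : x k ∈ Set.Icc c b := by
  obtain ⟨-, h0, hn, hlt⟩ := hx
  have mono : ∀ i j, i ≤ j → j ≤ n → x i ≤ x j := by
    intro i j hij
    induction j, hij using Nat.le_induction with
    | base => exact fun _ => le_rfl
    | succ j _ ih => exact fun hj => (ih (by omega)).trans (hlt j hj).le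
  exact ⟨h0 ▸ mono 0 k k.zero_le hk, hn ▸ mono k n hk le_rfl⟩

/-- The difference of two Riemann sums is controlled by the worst tags of the first partition
meeting each interval of the second. -/
theorem exists_abs_riemannSum_sub_le {f : ℝ → ℝ} {c b : ℝ} {n N : ℕ} {x y : ℕ → ℝ}
    (hx : IsPartition c b n x) (hy : IsPartition c b N y) (t r : ℕ → ℝ) :
    ∃ κ : ℕ → ℕ, (∀ j < N, κ j < n ∧ x (κ j) < y (j + 1) ∧ y j < x (κ j + 1)) ∧
      |RiemannSum f n x t - RiemannSum f N y r| ≤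
        ∑ j ∈ Finset.range N, |f (t (κ j)) - f (r j)| * (y (j + 1) - y j) := by
  have hxle : ∀ k < n, x k ≤ x (k + 1) := fun k hk => (hx.2.2.2 k hk).le
  have hyle : ∀ j < N, y j ≤ y (j + 1) := fun j hj => (hy.2.2.2 j hj).le
  have sumx : ∀ k < n, ∑ j ∈ Finset.range N, overlap (x k) (x (k + 1)) (y j) (y (j + 1)) =
      x (k + 1) - x k := fun k hk =>
    sum_overlap (hx.mem_Icc hk.le).1 (hxle k hk) (hx.mem_Icc hk).2 hy.2.1 hy.2.2.1
  have sumy : ∀ j < N, ∑ k ∈ Finset.range n, overlap (x k) (x (k + 1)) (y j) (y (j + 1)) =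
      y (j + 1) - y j := by
    intro j hj
    rw [← sum_overlap (hy.mem_Icc hj.le).1 (hyle j hj) (hy.mem_Icc hj).2 hx.2.1 hx.2.2.1]
    exact Finset.sum_congr rfl fun k hk =>
      overlap_comm (hxle k (Finset.mem_range.mp hk)) (hyle j hj)
  have hκ : ∀ j, ∃ k, j < N → (k < n ∧ x k < y (j + 1) ∧ y j < x (k + 1)) ∧
      ∀ i < n, overlap (x i) (x (i + 1)) (y j) (y (j + 1)) ≠ 0 →
        |f (t i) - f (r j)| ≤ |f (t k) - f (r j)| := by
    intro j
    by_cases hj : j < N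
    swap
    · exact ⟨0, fun h => absurd h hj⟩
    let s := {k ∈ Finset.range n | overlap (x k) (x (k + 1)) (y j) (y (j + 1)) ≠ 0}
    have hs : s.Nonempty := by
      obtain ⟨k, hk, hne⟩ := Finset.exists_ne_zero_of_sum_ne_zero
        ((sumy j hj).trans_ne (sub_pos.mpr (hy.2.2.2 j hj)).ne')
      exact ⟨k, Finset.mem_filter.mpr ⟨hk, hne⟩⟩
    obtain ⟨k, hk, hmax⟩ := s.exists_max_image (fun i => |f (t i) - f (r j)|) hs
    obtain ⟨hkn, hne⟩ := Finset.mem_filter.mp hk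
    have hkn := Finset.mem_range.mp hkn
    exact ⟨k, fun _ => ⟨⟨hkn, lt_of_overlap_ne_zero (hxle k hkn) (hyle j hj) hne⟩,
      fun i hi hne => hmax i (Finset.mem_filter.mpr ⟨Finset.mem_range.mpr hi, hne⟩)⟩⟩
  choose κ hκ using hκ
  refine ⟨κ, fun j hj => (hκ j hj).1, ?_⟩
  have e1 : RiemannSum f n x t = ∑ j ∈ Finset.range N, ∑ k ∈ Finset.range n,
      f (t k) * overlap (x k) (x (k + 1)) (y j) (y (j + 1)) := by
    rw [Finset.sum_comm]
    refine Finset.sum_congr rfl fun k hk => ?_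
    rw [← Finset.mul_sum, sumx k (Finset.mem_range.mp hk)]
  have e2 : RiemannSum f N y r = ∑ j ∈ Finset.range N, ∑ k ∈ Finset.range n,
      f (r j) * overlap (x k) (x (k + 1)) (y j) (y (j + 1)) := by
    refine Finset.sum_congr rfl fun j hj => ?_
    rw [← Finset.mul_sum, sumy j (Finset.mem_range.mp hj)]
  rw [e1, e2, ← Finset.sum_sub_distrib]
  refine (Finset.abs_sum_le_sum_abs _ _).trans (Finset.sum_le_sum fun j hj => ?_)
  have hj := Finset.mem_range.mp hj
  rw [← Finset.sum_sub_distrib, ← sumy j hj, Finset.mul_sum]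
  refine (Finset.abs_sum_le_sum_abs _ _).trans (Finset.sum_le_sum fun k hk => ?_)
  have h0 : 0 ≤ overlap (x k) (x (k + 1)) (y j) (y (j + 1)) := overlap_nonneg (hyle j hj)
  rw [← sub_mul, abs_mul, abs_of_nonneg h0]
  rcases h0.eq_or_lt with h0 | h0
  · simp [← h0]
  · exact mul_le_mul_of_nonneg_right ((hκ j hj).2 k (Finset.mem_range.mp hk) h0.ne') h0.le

/-- Cauchy criterion for Riemann integrability. -/
theorem exists_riemannIntegrableWith_of_cauchy {f : ℝ → ℝ} {c b : ℝ} (hcb : c < b)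
    (H : ∀ ε > 0, ∃ V : ℝ, ∃ δ > 0, ∀ n : ℕ, ∀ x t : ℕ → ℝ, IsPartition c b n x → MeshLT n x δ →
      (∀ k < n, t k ∈ Set.Icc (x k) (x (k + 1))) → |RiemannSum f n x t - V| < ε) :
    ∃ I, RiemannIntegrableWith c b f I := by
  let U : ℕ → ℝ := fun n =>
    RiemannSum f n (uniformPoint c b n) (fun k => uniformPoint c b n (k + 1))
  have near : ∀ δ > 0, ∀ ε V : ℝ, (∀ n : ℕ, ∀ x t : ℕ → ℝ, IsPartition c b n x → MeshLT n x δ →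
      (∀ k < n, t k ∈ Set.Icc (x k) (x (k + 1))) → |RiemannSum f n x t - V| < ε) →
      ∀ᶠ n in atTop, |U n - V| < ε := by
    intro δ hδ ε V hV
    filter_upwards [eventually_div_natCast_lt (b - c) hδ, eventually_gt_atTop 0] with n hn hn0
    have hp := isPartition_uniformPoint hcb hn0
    exact hV _ _ _ hp (meshLT_uniformPoint hn) fun k hk => ⟨(hp.2.2.2 k hk).le, le_rfl⟩
  have hcauchy : CauchySeq U := by
    refine Metric.cauchySeq_iff'.mpr fun ε hε => ?_
    obtain ⟨V, δ, hδ, hV⟩ := H (ε / 2) (half_pos hε)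
    obtain ⟨M, hM⟩ := eventually_atTop.mp (near δ hδ _ V hV)
    refine ⟨M, fun n hn => ?_⟩
    have h1 := abs_lt.mp (hM n hn)
    have h2 := abs_lt.mp (hM M le_rfl)
    rw [Real.dist_eq, abs_lt]
    constructor <;> linarith
  obtain ⟨I, hI⟩ := cauchySeq_tendsto_of_complete hcauchy
  refine ⟨I, fun ε hε => ?_⟩
  obtain ⟨V, δ, hδ, hV⟩ := H (ε / 2) (half_pos hε)
  have hIV : |I - V| ≤ ε / 2 :=
    le_of_tendsto (hI.sub_const V).abs ((near δ hδ _ V hV).mono fun _ => le_of_lt)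
  refine ⟨δ, hδ, fun n x t hx hm ht => ?_⟩
  have h1 := abs_lt.mp (hV n x t hx hm ht)
  have h2 := abs_le.mp hIV
  rw [abs_lt]
  constructor <;> linarith

theorem RightEndpointIntegrableWith.exists_riemannIntegrableWith {a b c L : ℝ} {f : ℝ → ℝ}
    (hf : RightEndpointIntegrableWith a b f L) (hac : a < c) (hcb : c < b) :
    ∃ I, RiemannIntegrableWith c b f I := by
  refine exists_riemannIntegrableWith_of_cauchy hcb fun ε hε => ?_
  obtain ⟨δ, hδ, H⟩ := hf.exists_rightSum_lt (hac.trans hcb) (show 0 < ε / 9 by positivity)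
  obtain ⟨m, ⟨hm1, hm2⟩, hm0⟩ := (((eventually_div_natCast_lt ((b - c) / 4)
    (show 0 < δ / 4 by positivity)).and (eventually_div_natCast_lt ((b - c) / 4)
    (sub_pos.mpr hac))).and (eventually_gt_atTop 0)).exists
  have hh : (b - c) / (4 * m : ℕ) = (b - c) / 4 / m := by push_cast; rw [div_div]
  rw [← hh] at hm1 hm2
  set h := (b - c) / (4 * m : ℕ)
  have hp := isPartition_uniformPoint hcb (show 0 < 4 * m by omega)
  set y := uniformPoint c b (4 * m)
  have hys : ∀ j, y (j + 1) - y j = h := uniformPoint_succ_sub c b (4 * m)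
  have hpos : 0 < h := hys 0 ▸ sub_pos.mpr (hp.2.2.2 0 hp.1)
  refine ⟨RiemannSum f (4 * m) y fun j => y (j + 1), h, hpos, fun n x t hx hmesh ht => ?_⟩
  obtain ⟨κ, hκ, hle⟩ := exists_abs_riemannSum_sub_le (f := f) hx hp t fun j => y (j + 1)
  simp only [hys] at hle
  have := sum_abs_sub_le H (hac.trans hcb).le hpos (by linarith) (by linarith)
    (fun j => t (κ j)) y (fun _ => rfl) hp.2.2.1
    (fun j hj => ?_) (fun j hj => ?_)
  · linarith
  · obtain ⟨h1, -⟩ := hκ j hj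
    exact ⟨(hx.mem_Icc h1.le).1.trans (ht _ h1).1, (ht _ h1).2.trans (hx.mem_Icc h1).2⟩
  · obtain ⟨h1, h2, h3⟩ := hκ j hj
    have h4 := hmesh _ h1
    obtain ⟨h5, h6⟩ := ht _ h1
    constructor <;> linarith

theorem RiemannIntegrableWith.exists_rightSum_lt {c b I δ ε : ℝ} {f : ℝ → ℝ} (hcb : c < b)
    (hI : RiemannIntegrableWith c b f I) (hδ : 0 < δ) (hε : 0 < ε) :
    ∃ S, RightSum f δ c b S ∧ |S - I| < ε := by
  obtain ⟨η, hη, H⟩ := hI ε hε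
  obtain ⟨n, ⟨hn1, hn2⟩, hn0⟩ := (((eventually_div_natCast_lt (b - c) hδ).and
    (eventually_div_natCast_lt (b - c) hη)).and (eventually_gt_atTop 0)).exists
  have hp := isPartition_uniformPoint hcb hn0
  have hS := rightSum_of_sequence (f := f) hp.2.2.2 (meshLT_uniformPoint hn1)
  rw [hp.2.1, hp.2.2.1] at hS
  exact ⟨_, hS, H _ _ _ hp (meshLT_uniformPoint hn2) fun k hk => ⟨(hp.2.2.2 k hk).le, le_rfl⟩⟩

/-- If `f` is right-endpoint Riemann integrable on `[a,b]` with value `L`, then `f` is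
Riemann integrable on `[c,b]` for every `a < c < b`, and the Riemann integrals
`∫_c^b f` tend to `L` as `c → a⁺`. -/
theorem integral_tendsto_of_rightEndpoint (a b : ℝ) (hab : a < b) (f : ℝ → ℝ)
    (L : ℝ) (hf : RightEndpointIntegrableWith a b f L) :
    ∃ I : ℝ → ℝ, (∀ c : ℝ, a < c → c < b → RiemannIntegrableWith c b f (I c)) ∧
      Filter.Tendsto I (nhdsWithin a (Set.Ioi a)) (nhds L) := by
  have hex : ∀ c, ∃ I, a < c → c < b → RiemannIntegrableWith c b f I := by
    intro c
    by_cases h : a < c ∧ c < b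
    · obtain ⟨I, hI⟩ := hf.exists_riemannIntegrableWith h.1 h.2
      exact ⟨I, fun _ _ => hI⟩
    · exact ⟨0, fun h1 h2 => absurd ⟨h1, h2⟩ h⟩
  choose I hI using hex
  refine ⟨I, hI, Metric.tendsto_nhds.mpr fun ε hε => ?_⟩
  obtain ⟨δ, hδ, H⟩ := hf.exists_rightSum_lt hab (show 0 < ε / 5 by positivity)
  obtain ⟨d, had, hd⟩ := exists_between (lt_min hab (lt_add_of_pos_right a hδ))
  obtain ⟨hdb, hdδ⟩ := lt_min_iff.mp hd
  obtain ⟨R, hR⟩ := exists_rightSum f hδ hdb.le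
  have hsmall : ∀ᶠ c in nhdsWithin a (Set.Ioi a), |f d| * (c - a) < ε / 5 := by
    have : Tendsto (fun c => |f d| * (c - a)) (nhds a) (nhds (|f d| * (a - a))) :=
      (continuous_const.mul (continuous_id.sub continuous_const)).tendsto a
    rw [sub_self, mul_zero] at this
    exact (this.mono_left nhdsWithin_le_nhds).eventually_lt_const (by positivity)
  filter_upwards [hsmall, Ioo_mem_nhdsGT had] with c hc ⟨hac, hcd⟩
  have toc : RightSum f δ a c (f c * (c - a)) := RightSum.step hac.le (by linarith)
  have h1 := abs_lt.mp (H _ ((toc.trans (RightSum.step hcd.le (by linarith))).trans hR))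
  have h2 := abs_lt.mp (H _ ((RightSum.step had.le (by linarith)).trans hR))
  obtain ⟨S, hS, hSI⟩ := (hI c hac (hcd.trans hdb)).exists_rightSum_lt (hcd.trans hdb) hδ
    (show 0 < ε / 5 by positivity)
  have h3 := abs_lt.mp (H _ (toc.trans hS))
  have h4 := abs_lt.mp hSI
  rw [← abs_of_pos (sub_pos.mpr hac), ← abs_mul, abs_lt] at hc
  rw [Real.dist_eq, abs_lt]
  constructor <;> linarith
end

section
/- Let f : [a,b] → ℝ be a bounded function and let ψ be a continuous function on the set {(x,y) : a ≤ x ≤ y ≤ b} with values in ℝ satisfying x ≤ ψ(x,y) ≤ y for all a ≤ x ≤ y ≤ b. If f is ψ-integrable on [a,b], i.e., there exists L ∈ ℝ such that for every ε > 0 there is δ > 0 such that for every partition P = {x_0 = a < x_1 < ... < x_n = b} with mesh ‖P‖ < δ one has |Σ_{k=1}^n f(ψ(x_{k-1},x_k))·(x_k − x_{k-1}) − L| < ε, then f is Riemann integrable on [a,b] with value L. -/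
open Finset Set

/-- `ChainSum F δ u v S`: some chain from `u` to `v` with positive steps of length `< δ` has
`S` as the sum of `F` over its steps. -/
inductive ChainSum (F : ℝ → ℝ → ℝ) (δ : ℝ) : ℝ → ℝ → ℝ → Prop
  | nil (u : ℝ) : ChainSum F δ u u 0
  | cons {u w v S : ℝ} : u < w → w - u < δ → ChainSum F δ w v S → ChainSum F δ u v (F u w + S)

namespace ChainSum

variable {F : ℝ → ℝ → ℝ} {δ u v w S T : ℝ}

theorem single (h : u < v) (hδ : v - u < δ) : ChainSum F δ u v (F u v) := by
  simpa using cons (F := F) h hδ (nil v)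

theorem append (h₁ : ChainSum F δ u v S) (h₂ : ChainSum F δ v w T) :
    ChainSum F δ u w (S + T) := by
  induction h₁ with
  | nil => simpa using h₂
  | cons h hδ _ ih => rw [add_assoc]; exact cons h hδ (ih h₂)

theorem exists_of_le (hδ : 0 < δ) (huv : u ≤ v) : ∃ S, ChainSum F δ u v S := by
  obtain ⟨n, hn⟩ := exists_nat_ge ((v - u) / (δ / 2))
  rw [div_le_iff₀ (by positivity)] at hn
  induction n generalizing u with
  | zero =>
    obtain rfl : u = v := by
      push_cast at hn
      linarith
    exact ⟨0, nil u⟩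
  | succ n ih =>
    by_cases h : u + δ / 2 ≤ v
    · obtain ⟨S, hS⟩ := ih h (by push_cast at hn; linarith)
      exact ⟨_, cons (by linarith) (by linarith) hS⟩
    · rcases huv.eq_or_lt with rfl | huv
      · exact ⟨0, nil u⟩
      · exact ⟨_, single huv (by linarith)⟩

theorem exists_seq (h : ChainSum F δ u v S) :
    ∃ (n : ℕ) (x : ℕ → ℝ), x 0 = u ∧ x n = v ∧ (∀ k < n, x k < x (k + 1)) ∧
      (∀ k < n, x (k + 1) - x k < δ) ∧ ∑ k ∈ Finset.range n, F (x k) (x (k + 1)) = S := by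
  induction h with
  | nil u => exact ⟨0, fun _ => u, by simp⟩
  | @cons u w v S h hδ _ ih =>
    obtain ⟨n, x, h0, hn, hlt, hmesh, hsum⟩ := ih
    refine ⟨n + 1, fun k => Nat.casesOn k u x, rfl, hn, ?_, ?_, ?_⟩
    · rintro (_ | k) hk
      · simpa [h0] using h
      · exact hlt k (by omega)
    · rintro (_ | k) hk
      · simpa [h0] using hδ
      · exact hmesh k (by omega)
    · rw [Finset.sum_range_succ']
      simp [h0, hsum, add_comm]

end ChainSum

/-- `ChainDiff F δ u v e`: `e` is the difference of two chain sums from `u` to `v`. -/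
def ChainDiff (F : ℝ → ℝ → ℝ) (δ u v e : ℝ) : Prop :=
  ∃ S T, ChainSum F δ u v S ∧ ChainSum F δ u v T ∧ S - T = e

namespace ChainDiff

variable {F : ℝ → ℝ → ℝ} {δ u v w d e : ℝ}

theorem zero (hδ : 0 < δ) (huv : u ≤ v) : ChainDiff F δ u v 0 := by
  obtain ⟨S, hS⟩ := ChainSum.exists_of_le (F := F) hδ huv
  exact ⟨S, S, hS, hS, sub_self S⟩

theorem append (h₁ : ChainDiff F δ u v d) (h₂ : ChainDiff F δ v w e) :
    ChainDiff F δ u w (d + e) := by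
  obtain ⟨S, T, hS, hT, rfl⟩ := h₁
  obtain ⟨S', T', hS', hT', rfl⟩ := h₂
  exact ⟨_, _, hS.append hS', hT.append hT', by ring⟩

theorem abs (h : ChainDiff F δ u v e) : ChainDiff F δ u v |e| := by
  rcases abs_choice e with he | he
  · rwa [he]
  · obtain ⟨S, T, hS, hT, rfl⟩ := h
    exact ⟨T, S, hT, hS, by rw [he]; ring⟩

theorem extend (hδ : 0 < δ) (h : ChainDiff F δ u v e) {u' v' : ℝ} (hu : u' ≤ u) (hv : v ≤ v') :
    ChainDiff F δ u' v' e := by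
  simpa using ((zero hδ hu).append h).append (zero hδ hv)

theorem sum {g e : ℕ → ℝ} {m : ℕ} (h : ∀ i < m, ChainDiff F δ (g i) (g (i + 1)) (e i)) :
    ChainDiff F δ (g 0) (g m) (∑ i ∈ Finset.range m, e i) := by
  induction m with
  | zero => exact ⟨0, 0, .nil _, .nil _, by simp⟩
  | succ m ih =>
    rw [Finset.sum_range_succ]
    exact (ih fun i hi => h i (by omega)).append (h m (by omega))

end ChainDiff

/-- A continuous `G` on `[a, c]` with `x ≤ G x ≤ x + h` has a monotone right inverse
on `[a + h, c]`. -/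
theorem exists_monotoneOn_rightInverse {a c h : ℝ} (hh : 0 ≤ h) {G : ℝ → ℝ}
    (hG : ContinuousOn G (Set.Icc a c)) (hGx : ∀ x ∈ Set.Icc a c, x ≤ G x ∧ G x ≤ x + h) :
    ∃ φ : ℝ → ℝ, MonotoneOn φ (Set.Icc (a + h) c) ∧
      ∀ s ∈ Set.Icc (a + h) c, s - h ≤ φ s ∧ φ s ≤ s ∧ G (φ s) = s := by
  have hbdd : ∀ s, BddBelow {x ∈ Set.Icc a c | s ≤ G x} := fun s => ⟨a, fun x hx => hx.1.1⟩
  have hmem : ∀ s ∈ Set.Icc (a + h) c, s ∈ {x ∈ Set.Icc a c | s ≤ G x} := by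
    rintro s ⟨hs₁, hs₂⟩
    have hs : s ∈ Set.Icc a c := ⟨by linarith, hs₂⟩
    exact ⟨hs, (hGx s hs).1⟩
  refine ⟨fun s => sInf {x ∈ Set.Icc a c | s ≤ G x}, ?_, ?_⟩
  · intro s _ t ht hst
    exact csInf_le_csInf (hbdd s) ⟨t, hmem t ht⟩ fun x hx => ⟨hx.1, hst.trans hx.2⟩
  · intro s hs
    have hclosed : IsClosed {x ∈ Set.Icc a c | s ≤ G x} :=
      hG.preimage_isClosed_of_isClosed isClosed_Icc isClosed_Ici
    obtain ⟨hφ, hsφ⟩ := hclosed.csInf_mem ⟨s, hmem s hs⟩ (hbdd s)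
    have hle := fun x hx => csInf_le (hbdd s) (a := x) hx
    dsimp only
    set y := sInf {x ∈ Set.Icc a c | s ≤ G x}
    refine ⟨by linarith [(hGx y hφ).2], hle s (hmem s hs), ?_⟩
    have ha : G a ≤ s := (hGx a ⟨le_rfl, hφ.1.trans hφ.2⟩).2.trans hs.1
    obtain ⟨x, hx, hxs⟩ := intermediate_value_Icc hφ.1
      (hG.mono (Set.Icc_subset_Icc_right hφ.2)) ⟨ha, hsφ⟩
    have hyx : y ≤ x := hle x ⟨⟨hx.1, hx.2.trans hφ.2⟩, hxs.ge⟩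
    rwa [← le_antisymm hx.2 hyx]

/-- Two intervals of length `h` with `ψ`-samples `s` and `t` are completed to two chains
between the same endpoints. -/
theorem exists_chainDiff_of_samples {a b M h δ : ℝ} {f : ℝ → ℝ} {ψ : ℝ → ℝ → ℝ}
    (hM : ∀ y ∈ Set.Icc a b, |f y| ≤ M)
    (hψ : ∀ u v : ℝ, a ≤ u → u ≤ v → v ≤ b → u ≤ ψ u v ∧ ψ u v ≤ v)
    (hh : 0 < h) (hhδ : h < δ) {x y : ℝ} (hax : a ≤ x) (hxy : x ≤ y) (hyb : y + h ≤ b)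
    (hδ : y - x < δ) :
    ∃ e, ChainDiff (fun u v => f (ψ u v) * (v - u)) δ x (y + h) e ∧
      h * |f (ψ x (x + h)) - f (ψ y (y + h))| ≤ e + 2 * M * (y - x) := by
  rcases hxy.eq_or_lt with rfl | hlt
  · exact ⟨0, .zero (by linarith) (by linarith), by simp⟩
  · have hS := (ChainSum.single (F := fun u v => f (ψ u v) * (v - u)) (δ := δ)
      (show x < x + h by linarith) (by linarith)).append
      (.single (show x + h < y + h by linarith) (by linarith))
    have hT := (ChainSum.single (F := fun u v => f (ψ u v) * (v - u)) (δ := δ) hlt hδ).append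
      (.single (show y < y + h by linarith) (by linarith))
    refine ⟨_, ChainDiff.abs ⟨_, _, hS, hT, rfl⟩, ?_⟩
    have h₁ := hψ (x + h) (y + h) (by linarith) (by linarith) hyb
    have h₂ := hψ x y hax hxy (by linarith)
    have b₁ := abs_le.1 (hM (ψ (x + h) (y + h)) ⟨by linarith [h₁.1], by linarith [h₁.2]⟩)
    have b₂ := abs_le.1 (hM (ψ x y) ⟨by linarith [h₂.1], by linarith [h₂.2]⟩)
    rw [← abs_of_pos hh, ← abs_mul, abs_of_pos hh]
    have key : |(f (ψ x y) - f (ψ (x + h) (y + h))) * (y - x)| ≤ 2 * M * (y - x) := by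
      rw [abs_mul, abs_of_pos (sub_pos.2 hlt)]
      refine mul_le_mul_of_nonneg_right (abs_le.2 ⟨?_, ?_⟩) (by linarith) <;> linarith
    refine le_trans (le_of_eq ?_) ((abs_add_le _ _).trans (add_le_add_right key _))
    congr 1
    ring

theorem sum_range_mul_eq_sum_sum {A : Type*} [AddCommMonoid A] (u : ℕ → A) (K m : ℕ) :
    ∑ i ∈ Finset.range (K * m), u i =
      ∑ r ∈ Finset.range K, ∑ q ∈ Finset.range m, u (K * q + r) := by
  rw [Finset.sum_comm]
  induction m with
  | zero => simp
  | succ m ih => rw [Nat.mul_succ, Finset.sum_range_add, ih, Finset.sum_range_succ]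

theorem sum_range_sub_two (u : ℕ → ℝ) (n : ℕ) :
    ∑ i ∈ Finset.range n, (u (i + 2) - u i) = u (n + 1) + u n - (u 1 + u 0) := by
  induction n with
  | zero => simp
  | succ n ih => rw [Finset.sum_range_succ, ih]; ring

/-- If all `ψ`-sums of mesh `< δ` lie within `ε` of each other, then on a grid of step `ℓ` the
oscillations of `f` over the interior double cells have a small sum. -/
theorem sum_osc_le {a b M δ ε ℓ : ℝ} {f : ℝ → ℝ} {ψ : ℝ → ℝ → ℝ} {k m : ℕ}
    (hM : ∀ y ∈ Set.Icc a b, |f y| ≤ M)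
    (hψc : ContinuousOn (fun p : ℝ × ℝ => ψ p.1 p.2)
      {p : ℝ × ℝ | a ≤ p.1 ∧ p.1 ≤ p.2 ∧ p.2 ≤ b})
    (hψ : ∀ u v : ℝ, a ≤ u → u ≤ v → v ≤ b → u ≤ ψ u v ∧ ψ u v ≤ v)
    (hdiff : ∀ e, ChainDiff (fun u v => f (ψ u v) * (v - u)) δ a b e → e ≤ ε)
    (hℓ : 0 < ℓ) (hk : 0 < k) (hδ : (k + 2) * ℓ < δ)
    (hN : a + ((2 * k + 2) * m + 2 * k + 1) * ℓ = b) {s t : ℕ → ℝ}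
    (hs : ∀ i < (2 * k + 2) * m, s i ∈ Set.Icc (a + (k + i) * ℓ) (a + (k + i + 2) * ℓ))
    (ht : ∀ i < (2 * k + 2) * m, t i ∈ Set.Icc (a + (k + i) * ℓ) (a + (k + i + 2) * ℓ)) :
    k * ℓ * ∑ i ∈ Finset.range ((2 * k + 2) * m), |f (s i) - f (t i)| ≤
      (2 * k + 2) * ε + 4 * M * (b - a) := by
  set n := (2 * k + 2) * m with hn
  have hnR : (n : ℝ) = (2 * k + 2) * m := by rw [hn]; push_cast; ring
  rw [← hnR] at hN
  have hkR : (0 : ℝ) < k := by exact_mod_cast hk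
  have hh : 0 < k * ℓ := by positivity
  have hab : a ≤ b := by rw [← hN]; exact le_add_of_nonneg_right (by positivity)
  have hM0 : 0 ≤ M := (abs_nonneg _).trans (hM a ⟨le_rfl, hab⟩)
  obtain ⟨φ, hφm, hφ⟩ := exists_monotoneOn_rightInverse (a := a) (c := b - k * ℓ) hh.le
    (G := fun x => ψ x (x + k * ℓ))
    (hψc.comp (f := fun x => (x, x + k * ℓ)) (by fun_prop) fun x hx =>
      ⟨hx.1, by simpa using hh.le, by simpa using (by linarith [hx.2] : x + k * ℓ ≤ b)⟩)
    (fun x hx => hψ x (x + k * ℓ) hx.1 (by linarith) (by linarith [hx.2]))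
  have hcell : ∀ j : ℕ, j ≤ n + 1 → a + (k + j) * ℓ ∈ Set.Icc (a + k * ℓ) (b - k * ℓ) := by
    intro j hj
    have hj' : (j : ℝ) * ℓ ≤ (n + 1) * ℓ :=
      mul_le_mul_of_nonneg_right (by exact_mod_cast hj) hℓ.le
    have : (0 : ℝ) ≤ j * ℓ := by positivity
    constructor <;> linarith
  have hblock : ∀ i < n, ∀ s t : ℝ, s ≤ t →
      s ∈ Set.Icc (a + (k + i) * ℓ) (a + (k + i + 2) * ℓ) →
      t ∈ Set.Icc (a + (k + i) * ℓ) (a + (k + i + 2) * ℓ) →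
      ∃ e, ChainDiff (fun u v => f (ψ u v) * (v - u)) δ (a + i * ℓ) (a + (i + (2 * k + 2)) * ℓ) e ∧
        k * ℓ * |f s - f t| ≤
          e + 2 * M * (φ (a + (k + (i + 2 : ℕ)) * ℓ) - φ (a + (k + i) * ℓ)) := by
    intro i hi s t hst hs ht
    have hc := hcell i (by omega)
    have hd := hcell (i + 2) (by omega)
    have hd' : a + (k + (i + 2 : ℕ)) * ℓ = a + (k + i + 2) * ℓ := by push_cast; ring
    rw [hd'] at hd ⊢
    have hs' : s ∈ Set.Icc (a + k * ℓ) (b - k * ℓ) := ⟨hc.1.trans hs.1, hs.2.trans hd.2⟩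
    have ht' : t ∈ Set.Icc (a + k * ℓ) (b - k * ℓ) := ⟨hc.1.trans ht.1, ht.2.trans hd.2⟩
    obtain ⟨hs₁, hs₂, hs₃⟩ := hφ s hs'
    obtain ⟨ht₁, ht₂, ht₃⟩ := hφ t ht'
    obtain ⟨e, he, hle⟩ := exists_chainDiff_of_samples hM hψ hh (by linarith)
      (by linarith [hs'.1]) (hφm hs' ht' hst) (by linarith [ht'.2])
      (show φ t - φ s < δ by linarith [hs.1, ht.2])
    rw [hs₃, ht₃] at hle
    refine ⟨e, he.extend (by linarith) (by linarith [hs.1]) (by linarith [ht.2]), hle.trans ?_⟩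
    have h₁ := hφm hc hs' hs.1
    have h₂ := hφm ht' hd ht.2
    gcongr
  have hex : ∀ i, ∃ e, i < n →
      ChainDiff (fun u v => f (ψ u v) * (v - u)) δ (a + i * ℓ) (a + (i + (2 * k + 2)) * ℓ) e ∧
        k * ℓ * |f (s i) - f (t i)| ≤
          e + 2 * M * (φ (a + (k + (i + 2 : ℕ)) * ℓ) - φ (a + (k + i) * ℓ)) := by
    intro i
    by_cases hi : i < n
    · rcases le_total (s i) (t i) with h | h
      · obtain ⟨e, he⟩ := hblock i hi _ _ h (hs i hi) (ht i hi)
        exact ⟨e, fun _ => he⟩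
      · obtain ⟨e, he⟩ := hblock i hi _ _ h (ht i hi) (hs i hi)
        exact ⟨e, fun _ => by rwa [abs_sub_comm]⟩
    · exact ⟨0, fun h => absurd h hi⟩
  choose e he using hex
  have hclass : ∀ r ∈ Finset.range (2 * k + 2),
      ∑ q ∈ Finset.range m, e ((2 * k + 2) * q + r) ≤ ε := by
    intro r hr
    rw [Finset.mem_range] at hr
    have hchain := ChainDiff.sum (F := fun u v => f (ψ u v) * (v - u)) (δ := δ)
      (g := fun q => a + ((2 * k + 2) * q + r) * ℓ)
      (e := fun q => e ((2 * k + 2) * q + r)) (m := m) fun q hq => by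
        have hlt : (2 * k + 2) * q + r < n := by
          have := Nat.mul_le_mul_left (2 * k + 2) (Nat.succ_le_of_lt hq)
          rw [Nat.mul_succ] at this
          omega
        convert (he _ hlt).1 using 1
        · push_cast; ring
        · push_cast; ring
    refine hdiff _ (hchain.extend (lt_trans (by positivity) hδ) ?_ ?_)
    · exact le_add_of_nonneg_right (by positivity)
    · have hr' : (r : ℝ) ≤ 2 * k + 1 := by exact_mod_cast Nat.le_of_lt_succ hr
      rw [← hN, hnR, add_assoc _ (2 * (k : ℝ)) 1]
      gcongr
  have hsum : ∑ i ∈ Finset.range n, e i ≤ (2 * k + 2) * ε := by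
    rw [hn, sum_range_mul_eq_sum_sum]
    refine (Finset.sum_le_sum hclass).trans_eq ?_
    simp
  have hφab : ∀ j : ℕ, j ≤ n + 1 → a ≤ φ (a + (k + j) * ℓ) ∧ φ (a + (k + j) * ℓ) ≤ b := by
    intro j hj
    have h₁ := hcell j hj
    have h₂ := hφ _ h₁
    constructor <;> linarith [h₁.1, h₁.2, h₂.1, h₂.2.1]
  have htel := sum_range_sub_two (fun j : ℕ => φ (a + (k + j) * ℓ)) n
  have htel' : ∑ i ∈ Finset.range n,
      (φ (a + (k + (i + 2 : ℕ)) * ℓ) - φ (a + (k + i) * ℓ)) ≤ 2 * (b - a) := by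
    refine htel.le.trans ?_
    linarith [(hφab (n + 1) le_rfl).2, (hφab n (by omega)).2, (hφab 1 (by omega)).1,
      (hφab 0 (by omega)).1]
  calc k * ℓ * ∑ i ∈ Finset.range n, |f (s i) - f (t i)|
      ≤ ∑ i ∈ Finset.range n,
          (e i + 2 * M * (φ (a + (k + (i + 2 : ℕ)) * ℓ) - φ (a + (k + i) * ℓ))) := by
        rw [Finset.mul_sum]
        exact Finset.sum_le_sum fun i hi => (he i (Finset.mem_range.1 hi)).2
    _ ≤ (2 * k + 2) * ε + 2 * M * (2 * (b - a)) := by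
        rw [Finset.sum_add_distrib, ← Finset.mul_sum]
        gcongr
    _ = (2 * k + 2) * ε + 4 * M * (b - a) := by ring

theorem IsPartition.le_of_le {a b : ℝ} {n : ℕ} {x : ℕ → ℝ} (hx : IsPartition a b n x) (i j : ℕ)
    (hij : i ≤ j) (hj : j ≤ n) : x i ≤ x j := by
  induction j, hij using Nat.le_induction with
  | base => exact le_rfl
  | succ j _ ih => exact (ih (by omega)).trans (hx.2.2.2 j (by omega)).le

/-- Oscillation sums over a partition finer than a uniform grid are bounded by those over the
double cells of the grid. -/
theorem exists_grid_samples {a b ℓ : ℝ} {N n : ℕ} {x s t : ℕ → ℝ} (f : ℝ → ℝ) (hℓ : 0 < ℓ)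
    (hN : a + N * ℓ = b) (hx : IsPartition a b n x) (hmesh : MeshLT n x ℓ)
    (hs : ∀ k < n, s k ∈ Set.Icc (x k) (x (k + 1)))
    (ht : ∀ k < n, t k ∈ Set.Icc (x k) (x (k + 1))) :
    ∃ s' t' : ℕ → ℝ,
      (∀ j < N, s' j ∈ Set.Icc a b ∧ s' j ∈ Set.Icc (a + j * ℓ) (a + (j + 2) * ℓ)) ∧
      (∀ j < N, t' j ∈ Set.Icc a b ∧ t' j ∈ Set.Icc (a + j * ℓ) (a + (j + 2) * ℓ)) ∧
      ∑ k ∈ Finset.range n, |f (s k) - f (t k)| * (x (k + 1) - x k) ≤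
        2 * ℓ * ∑ j ∈ Finset.range N, |f (s' j) - f (t' j)| := by
  have hmono := hx.le_of_le
  obtain ⟨-, h0, hn, hlt⟩ := hx
  set c : ℕ → ℕ := fun k => ⌊(x k - a) / ℓ⌋₊
  have hc₁ : ∀ k < n, a + c k * ℓ ≤ x k := by
    intro k hk
    have h : 0 ≤ (x k - a) / ℓ :=
      div_nonneg (by linarith [hmono 0 k (Nat.zero_le k) hk.le]) hℓ.le
    have := (le_div_iff₀ hℓ).1 (Nat.floor_le h)
    linarith
  have hc₂ : ∀ k < n, x (k + 1) ≤ a + (c k + 2) * ℓ := by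
    intro k hk
    have := (div_lt_iff₀ hℓ).1 (Nat.lt_floor_add_one ((x k - a) / ℓ))
    have := hmesh k hk
    simp only [c]
    linarith
  have hcN : ∀ k ∈ Finset.range n, c k ∈ Finset.range N := by
    intro k hk
    rw [Finset.mem_range] at hk ⊢
    have h₁ := hc₁ k hk
    have h₂ := hlt k hk
    have h₃ := hmono (k + 1) n hk le_rfl
    have : (c k : ℝ) * ℓ < N * ℓ := by linarith
    exact_mod_cast lt_of_mul_lt_mul_right this hℓ.le
  have hex : ∀ j, ∃ p : ℝ × ℝ, j < N →
      (p.1 ∈ Set.Icc a b ∧ p.1 ∈ Set.Icc (a + j * ℓ) (a + (j + 2) * ℓ)) ∧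
      (p.2 ∈ Set.Icc a b ∧ p.2 ∈ Set.Icc (a + j * ℓ) (a + (j + 2) * ℓ)) ∧
      ∀ k < n, c k = j → |f (s k) - f (t k)| ≤ |f p.1 - f p.2| := by
    intro j
    rcases ({k ∈ Finset.range n | c k = j}).eq_empty_or_nonempty with hemp | hne
    · refine ⟨(a + j * ℓ, a + j * ℓ), fun hj => ?_⟩
      have hmem : a + j * ℓ ∈ Set.Icc a b ∧
          a + j * ℓ ∈ Set.Icc (a + j * ℓ) (a + (j + 2) * ℓ) := by
        have : (j : ℝ) * ℓ ≤ N * ℓ := mul_le_mul_of_nonneg_right (by exact_mod_cast hj.le) hℓ.le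
        have : (0 : ℝ) ≤ j * ℓ := by positivity
        refine ⟨⟨?_, ?_⟩, ?_, ?_⟩ <;> linarith
      refine ⟨hmem, hmem, fun k hk hkj => ?_⟩
      exact absurd (Finset.mem_filter.2 ⟨Finset.mem_range.2 hk, hkj⟩) (hemp ▸ Finset.notMem_empty k)
    · obtain ⟨k, hk, hmax⟩ := Finset.exists_max_image _ (fun k => |f (s k) - f (t k)|) hne
      rw [Finset.mem_filter, Finset.mem_range] at hk
      obtain ⟨hk, rfl⟩ := hk
      have hmem : ∀ y ∈ Set.Icc (x k) (x (k + 1)),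
          y ∈ Set.Icc a b ∧ y ∈ Set.Icc (a + c k * ℓ) (a + (c k + 2) * ℓ) := fun y hy =>
        ⟨⟨by linarith [hy.1, hmono 0 k (Nat.zero_le k) hk.le],
          by linarith [hy.2, hmono (k + 1) n hk le_rfl]⟩,
          (hc₁ k hk).trans hy.1, hy.2.trans (hc₂ k hk)⟩
      exact ⟨(s k, t k), fun _ => ⟨hmem _ (hs k hk), hmem _ (ht k hk), fun i hi hik =>
        hmax i (Finset.mem_filter.2 ⟨Finset.mem_range.2 hi, hik⟩)⟩⟩
  choose p hp using hex
  have hlen : ∀ j, ∑ k ∈ Finset.range n with c k = j, (x (k + 1) - x k) ≤ 2 * ℓ := by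
    intro j
    set γ : ℝ → ℝ := fun y => max (a + j * ℓ) (min y (a + (j + 2) * ℓ))
    have hγ : Monotone γ := fun y z hyz => max_le_max le_rfl (min_le_min hyz le_rfl)
    calc ∑ k ∈ Finset.range n with c k = j, (x (k + 1) - x k)
        = ∑ k ∈ Finset.range n with c k = j, (γ (x (k + 1)) - γ (x k)) := by
          refine Finset.sum_congr rfl fun k hk => ?_
          rw [Finset.mem_filter, Finset.mem_range] at hk
          obtain ⟨hk, rfl⟩ := hk
          have h₁ := hc₁ k hk
          have h₂ := hc₂ k hk
          have h₃ := hlt k hk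
          simp only [γ]
          rw [min_eq_left h₂, min_eq_left (h₃.le.trans h₂), max_eq_right h₁,
            max_eq_right (h₁.trans h₃.le)]
      _ ≤ ∑ k ∈ Finset.range n, (γ (x (k + 1)) - γ (x k)) :=
          Finset.sum_le_sum_of_subset_of_nonneg (Finset.filter_subset _ _) fun k hk _ =>
            sub_nonneg.2 (hγ (hlt k (Finset.mem_range.1 hk)).le)
      _ = γ (x n) - γ (x 0) := Finset.sum_range_sub (fun k => γ (x k)) n
      _ ≤ 2 * ℓ := by
          have h₁ : γ (x n) ≤ a + (j + 2) * ℓ := max_le (by linarith) (min_le_right _ _)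
          have h₂ : a + j * ℓ ≤ γ (x 0) := le_max_left _ _
          linarith
  refine ⟨fun j => (p j).1, fun j => (p j).2, fun j hj => (hp j hj).1,
    fun j hj => (hp j hj).2.1, ?_⟩
  rw [← Finset.sum_fiberwise_of_maps_to hcN, Finset.mul_sum]
  refine Finset.sum_le_sum fun j hj => ?_
  calc ∑ k ∈ Finset.range n with c k = j, |f (s k) - f (t k)| * (x (k + 1) - x k)
      ≤ ∑ k ∈ Finset.range n with c k = j, |f (p j).1 - f (p j).2| * (x (k + 1) - x k) := by
        refine Finset.sum_le_sum fun k hk => ?_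
        rw [Finset.mem_filter, Finset.mem_range] at hk
        exact mul_le_mul_of_nonneg_right ((hp j (Finset.mem_range.1 hj)).2.2 k hk.1 hk.2)
          (sub_nonneg.2 (hlt k hk.1).le)
    _ ≤ 2 * ℓ * |f (p j).1 - f (p j).2| := by
        rw [← Finset.mul_sum, mul_comm]
        exact mul_le_mul_of_nonneg_right (hlen j) (abs_nonneg _)

/-- If `ψ` is a continuous choice of sample points (`x ≤ ψ(x,y) ≤ y` on
`{(x,y) : a ≤ x ≤ y ≤ b}`) and the `ψ`-Riemann sums of the bounded function `f`
converge to `L` as the mesh tends to `0`, then `f` is Riemann integrable on `[a,b]`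
with value `L`. -/
theorem riemann_of_psi_integrable (a b : ℝ) (hab : a < b) (f : ℝ → ℝ)
    (hbd : ∃ M : ℝ, ∀ y ∈ Set.Icc a b, |f y| ≤ M)
    (ψ : ℝ → ℝ → ℝ)
    (hψc : ContinuousOn (fun p : ℝ × ℝ => ψ p.1 p.2)
      {p : ℝ × ℝ | a ≤ p.1 ∧ p.1 ≤ p.2 ∧ p.2 ≤ b})
    (hψ : ∀ u v : ℝ, a ≤ u → u ≤ v → v ≤ b → u ≤ ψ u v ∧ ψ u v ≤ v)
    (L : ℝ)
    (hf : ∀ ε > 0, ∃ δ > 0, ∀ n : ℕ, ∀ x : ℕ → ℝ, IsPartition a b n x → MeshLT n x δ →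
      |∑ k ∈ Finset.range n, f (ψ (x k) (x (k + 1))) * (x (k + 1) - x k) - L| < ε) :
    RiemannIntegrableWith a b f L := by
  obtain ⟨M, hM⟩ := hbd
  have hM0 : 0 ≤ M := (abs_nonneg _).trans (hM a ⟨le_rfl, hab.le⟩)
  intro ε hε
  obtain ⟨δ, hδ, hfδ⟩ := hf (ε / 48) (by positivity)
  have hchain : ∀ S, ChainSum (fun u v => f (ψ u v) * (v - u)) δ a b S → |S - L| < ε / 48 := by
    intro S hS
    obtain ⟨n, x, h0, hn, hlt, hmesh, rfl⟩ := hS.exists_seq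
    refine hfδ n x ⟨Nat.pos_of_ne_zero ?_, h0, hn, hlt⟩ hmesh
    rintro rfl
    exact hab.ne (h0.symm.trans hn)
  have hdiff : ∀ e, ChainDiff (fun u v => f (ψ u v) * (v - u)) δ a b e → e ≤ ε / 24 := by
    rintro _ ⟨S, T, hS, hT, rfl⟩
    linarith [(abs_lt.1 (hchain S hS)).2, (abs_lt.1 (hchain T hT)).1]
  obtain ⟨k, hk⟩ := exists_nat_gt (32 * M * (b - a) / ε)
  have hk0 : (0 : ℝ) < k :=
    lt_of_le_of_lt (div_nonneg (mul_nonneg (by positivity) (sub_pos.2 hab).le) hε.le) hk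
  have hk1 : (1 : ℝ) ≤ k := by exact_mod_cast (by exact_mod_cast hk0 : 0 < k)
  rw [div_lt_iff₀ hε] at hk
  set ℓ₀ : ℝ := min (δ / (k + 2)) (ε / (16 * (M + 1) * (2 * k + 1)))
  have hℓ₀pos : 0 < ℓ₀ := lt_min (by positivity) (by positivity)
  obtain ⟨m, hm⟩ := exists_nat_gt ((b - a) / ℓ₀)
  set N : ℕ := k + (2 * k + 2) * m + (k + 1) with hNdef
  have hNR : (N : ℝ) = (2 * k + 2) * m + 2 * k + 1 := by rw [hNdef]; push_cast; ring
  have hNpos : (0 : ℝ) < N := by rw [hNR]; positivity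
  set ℓ : ℝ := (b - a) / N with hℓdef
  have hℓ : 0 < ℓ := div_pos (sub_pos.2 hab) hNpos
  have hN : a + N * ℓ = b := by rw [hℓdef]; field_simp; ring
  have hℓlt : ℓ < ℓ₀ := by
    rw [hℓdef, div_lt_iff₀ hNpos]
    rw [div_lt_iff₀ hℓ₀pos, mul_comm] at hm
    refine hm.trans_le (mul_le_mul_of_nonneg_left ?_ hℓ₀pos.le)
    have : (0 : ℝ) ≤ k * m := by positivity
    have : (0 : ℝ) ≤ m := by positivity
    rw [hNR]
    linarith
  have hℓδ : (k + 2) * ℓ < δ := by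
    rw [mul_comm, ← lt_div_iff₀ (by positivity)]
    exact hℓlt.trans_le (min_le_left _ _)
  have hedge : 4 * M * ℓ * (2 * k + 1) ≤ ε / 4 := by
    have h := hℓlt.trans_le (min_le_right _ _)
    rw [lt_div_iff₀ (by positivity)] at h
    have : 0 ≤ ℓ * (2 * k + 1) := by positivity
    linarith
  refine ⟨ℓ, hℓ, fun n x t hx hmesh ht => ?_⟩
  have hmono := hx.le_of_le
  obtain ⟨-, h0, hn, hlt⟩ := id hx
  have hψx : ∀ i < n, ψ (x i) (x (i + 1)) ∈ Set.Icc (x i) (x (i + 1)) := fun i hi =>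
    hψ _ _ (h0 ▸ hmono 0 i (Nat.zero_le i) hi.le) (hlt i hi).le (hn ▸ hmono (i + 1) n hi le_rfl)
  obtain ⟨s', t', hs', ht', hle⟩ := exists_grid_samples f hℓ hN hx hmesh ht hψx
  have hE : ∀ j < N, |f (s' j) - f (t' j)| ≤ 2 * M := fun j hj =>
    (abs_sub _ _).trans (by linarith [hM _ (hs' j hj).1, hM _ (ht' j hj).1])
  have hint := sum_osc_le (s := fun i => s' (k + i)) (t := fun i => t' (k + i)) (m := m)
    hM hψc hψ hdiff hℓ (by exact_mod_cast hk0) hℓδ (by rw [← hNR]; exact hN)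
    (fun i hi => by simpa using (hs' (k + i) (by omega)).2)
    (fun i hi => by simpa using (ht' (k + i) (by omega)).2)
  have hsplit : ∑ j ∈ Finset.range N, |f (s' j) - f (t' j)| ≤
      ∑ i ∈ Finset.range ((2 * k + 2) * m), |f (s' (k + i)) - f (t' (k + i))| +
        (2 * k + 1) * (2 * M) := by
    rw [hNdef, Finset.sum_range_add, Finset.sum_range_add]
    have h₁ := Finset.sum_le_card_nsmul (Finset.range k) (fun j => |f (s' j) - f (t' j)|)
      (2 * M) fun j hj => hE j (by rw [Finset.mem_range] at hj; omega)
    have h₂ := Finset.sum_le_card_nsmul (Finset.range (k + 1))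
      (fun j => |f (s' (k + (2 * k + 2) * m + j)) - f (t' (k + (2 * k + 2) * m + j))|)
      (2 * M) fun j hj => hE _ (by rw [Finset.mem_range] at hj; omega)
    simp only [Finset.card_range, nsmul_eq_mul] at h₁ h₂
    push_cast at h₂
    linarith
  set I := ∑ i ∈ Finset.range ((2 * k + 2) * m), |f (s' (k + i)) - f (t' (k + i))|
  have hint' : ℓ * I ≤ ε / 6 + ε / 8 := by
    refine le_of_mul_le_mul_left ?_ hk0
    have : ε * 1 ≤ ε * k := by gcongr
    linarith
  have hP := abs_lt.1 (hfδ n x hx fun i hi => (hmesh i hi).trans (by nlinarith))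
  have hRP : |RiemannSum f n x t -
      ∑ i ∈ Finset.range n, f (ψ (x i) (x (i + 1))) * (x (i + 1) - x i)| ≤
      2 * ℓ * ∑ j ∈ Finset.range N, |f (s' j) - f (t' j)| := by
    refine le_trans ?_ hle
    rw [RiemannSum, ← Finset.sum_sub_distrib]
    refine (Finset.abs_sum_le_sum_abs _ _).trans (Finset.sum_le_sum fun i hi => ?_)
    rw [← sub_mul, abs_mul, abs_of_pos (sub_pos.2 (hlt i (Finset.mem_range.1 hi)))]
  have htotal : 2 * ℓ * ∑ j ∈ Finset.range N, |f (s' j) - f (t' j)| ≤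
      2 * ℓ * (I + (2 * k + 1) * (2 * M)) := by gcongr
  have hRP' := abs_le.1 (hRP.trans htotal)
  rw [abs_lt]
  constructor <;> linarith [hRP'.1, hRP'.2, hP.1, hP.2]
end
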